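/- arXiv:2208.01990 — 2 statements merged into one kernel-verified Lean document; each statement's English description precedes it below -/
import Mathlib

section
/- Let (Z_t)_{t≥0} be a process adapted to the filtration (with each Z_t bounded) that is a.s. non-increasing (Z_{t+1} ≤ Z_t a.s. for all t) and uniformly bounded (there exist reals a < b with a ≤ Z_t ≤ b a.s. for all t). Assume ℱ_0 is trivial, so that each ρ_t(Z_t) is (a.s. equal to) a real number. Then the limit ρ_∞(Z) := lim_{t→∞} ρ_t(Z_t) exists in ℝ. -/
open MeasureTheory Filter

/-- A bounded real-valued function (bounded random variable). -/
def Bdd {Ω : Type*} (X : Ω → ℝ) : Prop := ∃ C : ℝ, ∀ ω, |X ω| ≤ C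

/-- Nested application of the conditional risk mappings:
`nest σ i n X = σ (i+1) (σ (i+2) (⋯ (σ (i+n) X) ⋯))`, so that the nested risk measure of the
paper is `ρ_t(X) = nest σ 0 t X = σ 1 (σ 2 (⋯ (σ t X) ⋯))`. -/
def nest {Ω : Type*} (σ : ℕ → (Ω → ℝ) → (Ω → ℝ)) : ℕ → ℕ → (Ω → ℝ) → (Ω → ℝ)
  | _, 0, X => X
  | i, n + 1, X => σ (i + 1) (nest σ (i + 1) n X)

theorem nest_succ_right {Ω : Type*} (σ : ℕ → (Ω → ℝ) → (Ω → ℝ)) (n : ℕ) :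
    ∀ (i : ℕ) (X : Ω → ℝ), nest σ i (n + 1) X = nest σ i n (σ (i + n + 1) X) := by
  induction n with
  | zero => intro i X; rfl
  | succ n ih =>
    intro i X
    have h := ih (i + 1) X
    have e : i + 1 + n + 1 = i + (n + 1) + 1 := by omega
    rw [e] at h
    change σ (i + 1) (nest σ (i + 1) (n + 1) X) = σ (i + 1) (nest σ (i + 1) n _)
    rw [h]

theorem nest_bdd {Ω : Type*} (σ : ℕ → (Ω → ℝ) → (Ω → ℝ))
    (hσ_bdd : ∀ t, 1 ≤ t → ∀ X : Ω → ℝ, Bdd X → Bdd (σ t X)) (n : ℕ) :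
    ∀ (i : ℕ) (X : Ω → ℝ), Bdd X → Bdd (nest σ i n X) := by
  induction n with
  | zero => intro i X h; exact h
  | succ n ih => intro i X h; exact hσ_bdd _ (by omega) _ (ih _ _ h)

theorem nest_mono {Ω : Type*} {mΩ : MeasurableSpace Ω} (P : Measure Ω)
    (σ : ℕ → (Ω → ℝ) → (Ω → ℝ))
    (hσ_bdd : ∀ t, 1 ≤ t → ∀ X : Ω → ℝ, Bdd X → Bdd (σ t X))
    (hσ_mono : ∀ t, 1 ≤ t → ∀ X Y : Ω → ℝ, Bdd X → Bdd Y →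
      (∀ᵐ ω ∂P, X ω ≤ Y ω) → ∀ᵐ ω ∂P, σ t X ω ≤ σ t Y ω) (n : ℕ) :
    ∀ (i : ℕ) (X Y : Ω → ℝ), Bdd X → Bdd Y →
      (∀ᵐ ω ∂P, X ω ≤ Y ω) → ∀ᵐ ω ∂P, nest σ i n X ω ≤ nest σ i n Y ω := by
  induction n with
  | zero => intro i X Y _ _ h; exact h
  | succ n ih =>
    intro i X Y hX hY h
    exact hσ_mono _ (by omega) _ _ (nest_bdd σ hσ_bdd _ _ _ hX) (nest_bdd σ hσ_bdd _ _ _ hY)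
      (ih _ _ _ hX hY h)

theorem const_of_meas_bot {Ω : Type*} (f : Ω → ℝ) (hf : Measurable[⊥] f) (x y : Ω) :
    f x = f y := by
  have h : MeasurableSet[⊥] (f ⁻¹' {f y}) := hf (measurableSet_singleton _)
  rcases MeasurableSpace.measurableSet_bot_iff.1 h with h | h
  · have : y ∈ f ⁻¹' {f y} := rfl
    rw [h] at this
    exact this.elim
  · have : x ∈ f ⁻¹' {f y} := by rw [h]; trivial
    exact this

/-- If `(Z_t)` is adapted, bounded, a.s. non-increasing and uniformly bounded
(`a ≤ Z_t ≤ b` a.s. for some reals `a < b`), the conditional risk mappings `σ_t` are monotone,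
translation invariant and support-bounded, and `ℱ_0` is trivial, then the limit
`ρ_∞(Z) = lim_t ρ_t(Z_t)` exists in `ℝ`. -/
theorem nested_risk_limit_exists
    {Ω : Type*} {mΩ : MeasurableSpace Ω} (P : Measure Ω) [IsProbabilityMeasure P]
    (F : ℕ → MeasurableSpace Ω) (hF_mono : Monotone F) (hF_le : ∀ t, F t ≤ mΩ)
    (hF0 : F 0 = ⊥)
    (σ : ℕ → (Ω → ℝ) → (Ω → ℝ))
    (hσ_bdd : ∀ t, 1 ≤ t → ∀ X : Ω → ℝ, Bdd X → Bdd (σ t X))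
    (hσ_meas : ∀ t, 1 ≤ t → ∀ X : Ω → ℝ, Bdd X → Measurable[F (t - 1)] (σ t X))
    (hσ_mono : ∀ t, 1 ≤ t → ∀ X Y : Ω → ℝ, Bdd X → Bdd Y →
      (∀ᵐ ω ∂P, X ω ≤ Y ω) → ∀ᵐ ω ∂P, σ t X ω ≤ σ t Y ω)
    (hσ_trans : ∀ t, 1 ≤ t → ∀ X C : Ω → ℝ, Bdd X → Bdd C → Measurable[F (t - 1)] C →
      σ t (fun ω => X ω + C ω) =ᵐ[P] fun ω => σ t X ω + C ω)
    (hσ_supp : ∀ t, 1 ≤ t → ∀ X : Ω → ℝ, Bdd X →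
      ∀ᵐ ω ∂P, essInf X P ≤ σ t X ω ∧ σ t X ω ≤ essSup X P)
    (Z : ℕ → Ω → ℝ)
    (hZ_meas : ∀ t, Measurable[F t] (Z t))
    (hZ_bdd : ∀ t, Bdd (Z t))
    (hZ_dec : ∀ t, ∀ᵐ ω ∂P, Z (t + 1) ω ≤ Z t ω)
    (a b : ℝ) (hab : a < b)
    (hZ_ab : ∀ t, ∀ᵐ ω ∂P, a ≤ Z t ω ∧ Z t ω ≤ b) :
    ∃ L : ℝ, ∀ᵐ ω ∂P, Tendsto (fun t => nest σ 0 t (Z t) ω) atTop (nhds L) := by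
  have hc : ∀ c : ℝ, Bdd (fun _ : Ω => c) := fun c => ⟨|c|, fun _ => le_rfl⟩
  have hσc : ∀ t, 1 ≤ t → ∀ c : ℝ, ∀ᵐ ω ∂P, σ t (fun _ => c) ω = c := by
    intro t ht c
    filter_upwards [hσ_supp t ht _ (hc c)] with ω h
    rw [essInf_const c (IsProbabilityMeasure.ne_zero P),
      essSup_const c (IsProbabilityMeasure.ne_zero P)] at h
    exact le_antisymm h.2 h.1
  have hlow : ∀ n i (X : Ω → ℝ), Bdd X → (∀ᵐ ω ∂P, a ≤ X ω) →
      ∀ᵐ ω ∂P, a ≤ nest σ i n X ω := by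
    intro n
    induction n with
    | zero => intro i X _ h; exact h
    | succ n ih =>
      intro i X hX h
      have h1 := hσ_mono (i + 1) (by omega) (fun _ => a) _ (hc a)
        (nest_bdd σ hσ_bdd n (i + 1) X hX) (ih (i + 1) X hX h)
      filter_upwards [h1, hσc (i + 1) (by omega) a] with ω h1 h2
      rw [h2] at h1
      exact h1
  have hlow' : ∀ᵐ ω ∂P, ∀ t, a ≤ nest σ 0 t (Z t) ω := by
    rw [ae_all_iff]
    intro t
    exact hlow t 0 _ (hZ_bdd t) ((hZ_ab t).mono fun ω h => h.1)
  have hdec : ∀ᵐ ω ∂P, ∀ t, nest σ 0 (t + 1) (Z (t + 1)) ω ≤ nest σ 0 t (Z t) ω := by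
    rw [ae_all_iff]
    intro t
    rw [nest_succ_right]
    refine nest_mono P σ hσ_bdd hσ_mono t 0 _ _ (hσ_bdd _ (by omega) _ (hZ_bdd _)) (hZ_bdd t) ?_
    rw [Nat.zero_add]
    have h1 := hσ_mono (t + 1) (by omega) _ _ (hZ_bdd (t + 1)) (hZ_bdd t) (hZ_dec t)
    have h2 := hσ_trans (t + 1) (by omega) (fun _ => 0) (Z t) (hc 0) (hZ_bdd t) (hZ_meas t)
    simp only [zero_add] at h2
    filter_upwards [h1, h2, hσc (t + 1) (by omega) 0] with ω h1 h2 h3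
    have h2' : σ (t + 1) (Z t) ω = σ (t + 1) (fun _ => 0) ω + Z t ω := h2
    linarith
  have hconst : ∀ t x y, nest σ 0 t (Z t) x = nest σ 0 t (Z t) y := by
    intro t x y
    apply const_of_meas_bot
    rw [← hF0]
    cases t with
    | zero => exact hZ_meas 0
    | succ n => exact hσ_meas 1 le_rfl _ (nest_bdd σ hσ_bdd n 1 _ (hZ_bdd _))
  obtain ⟨ω₀, hl, hd⟩ := (hlow'.and hdec).exists
  have hanti : Antitone (fun t => nest σ 0 t (Z t) ω₀) := antitone_nat_of_succ_le hd
  refine ⟨⨅ t, nest σ 0 t (Z t) ω₀, Eventually.of_forall fun ω => ?_⟩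
  · have e : (fun t => nest σ 0 t (Z t) ω) = fun t => nest σ 0 t (Z t) ω₀ :=
      funext fun t => hconst t ω ω₀
    rw [e]
    exact tendsto_atTop_ciInf hanti ⟨a, by rintro _ ⟨t, rfl⟩; exact hl t⟩
end

section
/- Let (Z_t)_{t≥0} be a process adapted to the filtration with Z_0 bounded, and suppose there are deterministic reals ε_t ≥ 0 with ∑_{t=0}^∞ ε_t < ∞ such that 0 ≤ Z_{t+1} − Z_t ≤ ε_t a.s. for all t ≥ 0. Then for all t ≥ 0 and s ≥ 0, writing e_t := ∑_{τ≥t} ε_τ, one has 0 ≤ ρ_{t+s}(Z_{t+s}) − ρ_t(Z_t) ≤ e_t a.s.; consequently there exists a bounded ℱ_0-measurable random variable R such that esssup |ρ_t(Z_t) − R| → 0 as t → ∞, i.e. ρ_t(Z_t) converges uniformly (in essential sup norm) to R. -/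
open MeasureTheory Filter

theorem Bdd_const {Ω : Type*} (c : ℝ) : Bdd (fun _ : Ω => c) := ⟨|c|, fun _ => le_rfl⟩

theorem Bdd_add {Ω : Type*} {X Y : Ω → ℝ} (hX : Bdd X) (hY : Bdd Y) :
    Bdd (fun ω => X ω + Y ω) := by
  obtain ⟨a, ha⟩ := hX
  obtain ⟨b, hb⟩ := hY
  exact ⟨a + b, fun ω => (abs_add_le _ _).trans (add_le_add (ha ω) (hb ω))⟩

/-- If `Z_0` is bounded and `0 ≤ Z_{t+1} − Z_t ≤ ε_t` a.s. with deterministic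
`ε_t ≥ 0`, `∑ ε_t < ∞`, then `0 ≤ ρ_{t+s}(Z_{t+s}) − ρ_t(Z_t) ≤ e_t` a.s. where
`e_t = ∑_{τ ≥ t} ε_τ`; consequently `ρ_t(Z_t)` converges uniformly (in essential sup norm) to
a bounded `ℱ_0`-measurable random variable `R`. -/
theorem nested_risk_uniform_convergence
    {Ω : Type*} {mΩ : MeasurableSpace Ω} (P : Measure Ω) [IsProbabilityMeasure P]
    (F : ℕ → MeasurableSpace Ω) (hF_mono : Monotone F) (hF_le : ∀ t, F t ≤ mΩ)
    (σ : ℕ → (Ω → ℝ) → (Ω → ℝ))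
    (hσ_bdd : ∀ t, 1 ≤ t → ∀ X : Ω → ℝ, Bdd X → Bdd (σ t X))
    (hσ_meas : ∀ t, 1 ≤ t → ∀ X : Ω → ℝ, Bdd X → Measurable[F (t - 1)] (σ t X))
    (hσ_mono : ∀ t, 1 ≤ t → ∀ X Y : Ω → ℝ, Bdd X → Bdd Y →
      (∀ᵐ ω ∂P, X ω ≤ Y ω) → ∀ᵐ ω ∂P, σ t X ω ≤ σ t Y ω)
    (hσ_trans : ∀ t, 1 ≤ t → ∀ X C : Ω → ℝ, Bdd X → Bdd C → Measurable[F (t - 1)] C →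
      σ t (fun ω => X ω + C ω) =ᵐ[P] fun ω => σ t X ω + C ω)
    (hσ_supp : ∀ t, 1 ≤ t → ∀ X : Ω → ℝ, Bdd X →
      ∀ᵐ ω ∂P, essInf X P ≤ σ t X ω ∧ σ t X ω ≤ essSup X P)
    (Z : ℕ → Ω → ℝ)
    (hZ_meas : ∀ t, Measurable[F t] (Z t))
    (hZ_bdd : ∀ t, Bdd (Z t))
    (hZ0_bdd : Bdd (Z 0))
    (ε : ℕ → ℝ) (hε_nonneg : ∀ t, 0 ≤ ε t) (hε_sum : Summable ε)
    (hZ_inc : ∀ t : ℕ, ∀ᵐ ω ∂P, 0 ≤ Z (t + 1) ω - Z t ω ∧ Z (t + 1) ω - Z t ω ≤ ε t) :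
    (∀ t s : ℕ, ∀ᵐ ω ∂P,
        0 ≤ nest σ 0 (t + s) (Z (t + s)) ω - nest σ 0 t (Z t) ω ∧
        nest σ 0 (t + s) (Z (t + s)) ω - nest σ 0 t (Z t) ω ≤ ∑' τ : ℕ, ε (t + τ)) ∧
    ∃ R : Ω → ℝ, Bdd R ∧ Measurable[F 0] R ∧
      Tendsto (fun t => essSup (fun ω => |nest σ 0 t (Z t) ω - R ω|) P) atTop (nhds 0) := by
  have nbdd : ∀ n i X, Bdd X → Bdd (nest σ i n X) := by
    intro n
    induction n with
    | zero => intro i X h; exact h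
    | succ n ih => intro i X h; exact hσ_bdd (i + 1) (by omega) _ (ih _ _ h)
  have nmono : ∀ n i X Y, Bdd X → Bdd Y → (∀ᵐ ω ∂P, X ω ≤ Y ω) →
      ∀ᵐ ω ∂P, nest σ i n X ω ≤ nest σ i n Y ω := by
    intro n
    induction n with
    | zero => intro i X Y _ _ h; exact h
    | succ n ih =>
      intro i X Y hX hY h
      exact hσ_mono (i + 1) (by omega) _ _ (nbdd _ _ _ hX) (nbdd _ _ _ hY) (ih _ _ _ hX hY h)
  have ntrans : ∀ n i X (c : ℝ), Bdd X →
      ∀ᵐ ω ∂P, nest σ i n (fun ω => X ω + c) ω ≤ nest σ i n X ω + c := by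
    intro n
    induction n with
    | zero => intro i X c _; exact Eventually.of_forall fun _ => le_rfl
    | succ n ih =>
      intro i X c hX
      have h1 := hσ_mono (i + 1) (by omega) _ _ (nbdd n (i + 1) _ (Bdd_add hX (Bdd_const c)))
        (Bdd_add (nbdd n (i + 1) _ hX) (Bdd_const c)) (ih (i + 1) X c hX)
      have h2 := hσ_trans (i + 1) (by omega) (nest σ (i + 1) n X) (fun _ => c)
        (nbdd _ _ _ hX) (Bdd_const c) measurable_const
      filter_upwards [h1, h2] with ω a b
      exact a.trans b.le
  have sfix : ∀ t (C : Ω → ℝ), Bdd C → Measurable[F t] C →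
      ∀ᵐ ω ∂P, σ (t + 1) C ω = C ω := by
    intro t C hC hm
    have h1 := hσ_trans (t + 1) (by omega) (fun _ => 0) C (Bdd_const 0) hC hm
    have h2 := hσ_supp (t + 1) (by omega) (fun _ => 0) (Bdd_const 0)
    rw [essInf_const' (0 : ℝ), essSup_const' (0 : ℝ)] at h2
    simp only [zero_add] at h1
    filter_upwards [h1, h2] with ω a b
    have : σ (t + 1) (fun _ => 0) ω = 0 := le_antisymm b.2 b.1
    have a' : σ (t + 1) C ω = σ (t + 1) (fun _ => 0) ω + C ω := a
    rw [a', this, zero_add]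
  have step : ∀ t, ∀ᵐ ω ∂P, nest σ 0 t (Z t) ω ≤ nest σ 0 (t + 1) (Z (t + 1)) ω ∧
      nest σ 0 (t + 1) (Z (t + 1)) ω ≤ nest σ 0 t (Z t) ω + ε t := by
    intro t
    have bu := Bdd_add (hZ_bdd t) (Bdd_const (ε t))
    have mu : Measurable[F t] (fun ω => Z t ω + ε t) :=
      Measurable.add_const (hZ_meas t) (ε t)
    have f1 := sfix t _ (hZ_bdd t) (hZ_meas t)
    have f2 := sfix t _ bu mu
    have m1 := hσ_mono (t + 1) (by omega) (Z t) (Z (t + 1)) (hZ_bdd _) (hZ_bdd _)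
      (by filter_upwards [hZ_inc t] with ω h; linarith [h.1])
    have m2 := hσ_mono (t + 1) (by omega) (Z (t + 1)) _ (hZ_bdd _) bu
      (by filter_upwards [hZ_inc t] with ω h; linarith [h.2])
    have bs := hσ_bdd (t + 1) (by omega) _ (hZ_bdd (t + 1))
    have n1 := nmono t 0 (Z t) (σ (t + 1) (Z (t + 1))) (hZ_bdd t) bs
      (by filter_upwards [f1, m1] with ω a b; linarith)
    have n2 := nmono t 0 (σ (t + 1) (Z (t + 1))) _ bs bu
      (by filter_upwards [f2, m2] with ω a b; linarith)
    have n3 := ntrans t 0 (Z t) (ε t) (hZ_bdd t)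
    rw [nest_succ_right, Nat.zero_add]
    filter_upwards [n1, n2, n3] with ω a b c
    exact ⟨a, b.trans c⟩
  have sumt : ∀ t, Summable (fun τ => ε (t + τ)) := fun t => by
    simpa [add_comm] using (summable_nat_add_iff t).2 hε_sum
  have main : ∀ t s : ℕ, ∀ᵐ ω ∂P,
        0 ≤ nest σ 0 (t + s) (Z (t + s)) ω - nest σ 0 t (Z t) ω ∧
        nest σ 0 (t + s) (Z (t + s)) ω - nest σ 0 t (Z t) ω ≤ ∑' τ : ℕ, ε (t + τ) := by
    intro t s
    filter_upwards [ae_all_iff.2 step] with ω h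
    have key : 0 ≤ nest σ 0 (t + s) (Z (t + s)) ω - nest σ 0 t (Z t) ω ∧
        nest σ 0 (t + s) (Z (t + s)) ω - nest σ 0 t (Z t) ω ≤
          ∑ τ ∈ Finset.range s, ε (t + τ) := by
      induction s with
      | zero => simp
      | succ s ih =>
        rw [Finset.sum_range_succ]
        have := h (t + s)
        rw [← add_assoc]
        constructor <;> linarith [this.1, this.2, ih.1, ih.2]
    exact ⟨key.1, key.2.trans ((sumt t).sum_le_tsum _ fun _ _ => hε_nonneg _)⟩
  refine ⟨main, ?_⟩
  have rmeas : ∀ t, Measurable[F 0] (nest σ 0 t (Z t)) := by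
    intro t
    cases t with
    | zero => exact hZ_meas 0
    | succ t => exact hσ_meas 1 le_rfl _ (nbdd t 1 _ (hZ_bdd _))
  set E : ℝ := ∑' τ : ℕ, ε (0 + τ) with hE
  have E0 : 0 ≤ E := tsum_nonneg fun _ => hε_nonneg _
  let g : ℕ → Ω → ℝ := fun t ω => min (max (nest σ 0 t (Z t) ω - Z 0 ω) 0) E
  have g0 : ∀ t ω, 0 ≤ g t ω := fun t ω => le_min (le_max_right _ _) E0
  have gE : ∀ t ω, g t ω ≤ E := fun t ω => min_le_right _ _
  have gb : ∀ ω, BddAbove (Set.range fun t => g t ω) := fun ω =>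
    ⟨E, by rintro _ ⟨t, rfl⟩; exact gE t ω⟩
  have gm : ∀ t, Measurable[F 0] (g t) := fun t =>
    Measurable.min (Measurable.max (Measurable.sub (rmeas t) (hZ_meas 0)) measurable_const)
      measurable_const
  have sm : Measurable[F 0] (fun ω => ⨆ t, g t ω) := Measurable.iSup gm
  have sb : Bdd (fun ω => ⨆ t, g t ω) := by
    refine ⟨E, fun ω => ?_⟩
    rw [abs_of_nonneg ((g0 0 ω).trans (le_ciSup (gb ω) 0))]
    exact ciSup_le fun t => gE t ω
  refine ⟨fun ω => Z 0 ω + ⨆ t, g t ω, Bdd_add (hZ_bdd 0) sb, Measurable.add (hZ_meas 0) sm, ?_⟩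
  have bound : ∀ t, ∀ᵐ ω ∂P, |nest σ 0 t (Z t) ω - (Z 0 ω + ⨆ t, g t ω)| ≤
      ∑' τ : ℕ, ε (t + τ) := by
    intro t
    filter_upwards [ae_all_iff.2 fun t => ae_all_iff.2 (main t)] with ω h
    have gid : ∀ u, g u ω = nest σ 0 u (Z u) ω - Z 0 ω := by
      intro u
      have := h 0 u
      rw [Nat.zero_add] at this
      change min (max _ 0) E = _
      change 0 ≤ _ - Z 0 ω ∧ _ - Z 0 ω ≤ _ at this
      rw [max_eq_left this.1]
      exact min_eq_left this.2
    have lo : g t ω ≤ ⨆ t, g t ω := le_ciSup (gb ω) t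
    have hi : ⨆ u, g u ω ≤ g t ω + ∑' τ : ℕ, ε (t + τ) := by
      refine ciSup_le fun u => ?_
      rw [gid, gid]
      rcases le_total t u with htu | htu
      · obtain ⟨s, rfl⟩ := Nat.exists_eq_add_of_le htu
        linarith [(h t s).2]
      · obtain ⟨s, rfl⟩ := Nat.exists_eq_add_of_le htu
        have e0 : 0 ≤ ∑' τ : ℕ, ε (u + s + τ) := tsum_nonneg fun _ => hε_nonneg _
        linarith [(h u s).1]
    rw [gid] at lo hi
    rw [abs_le]
    constructor <;> linarith
  have lim : Tendsto (fun t => ∑' τ : ℕ, ε (t + τ)) atTop (nhds 0) := by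
    simpa [add_comm] using tendsto_sum_nat_add ε
  refine tendsto_of_tendsto_of_tendsto_of_le_of_le tendsto_const_nhds lim ?_ ?_
  · intro t
    refine le_limsup_of_frequently_le (Eventually.of_forall fun ω => abs_nonneg _).frequently ?_
    exact isBoundedUnder_of_eventually_le (bound t)
  · intro t
    refine limsup_le_of_le ?_ (bound t)
    exact isCoboundedUnder_le_of_le (ae P) (x := (0 : ℝ)) (fun ω => abs_nonneg _)
end
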